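/- arXiv:2211.06155 — 2 statements merged into one kernel-verified Lean document; each statement's English description precedes it below -/
import Mathlib

section
/- Let κ > 0 and p > 1 be real numbers. Then there exists a constant C > 0, depending only on κ and p, such that for every t ≥ 0, ∫₀ᵗ (1 + t − s) e^{−κ(t−s)} (1 + s)^p e^{−κps} ds ≤ C (1 + t) e^{−κt}. -/
/-- A power of `1 + s` is dominated on `[0, ∞)` by any growing exponential. -/
lemma one_add_rpow_le_mul_exp {p c s : ℝ} (hp : 0 < p) (hc : 0 < c) (hs : 0 ≤ s) :
    (1 + s) ^ p ≤ (1 + p / c) ^ p * Real.exp (c * s) := by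
  have hlin : 1 + s ≤ (1 + p / c) * Real.exp (c / p * s) := by
    calc 1 + s ≤ (1 + p / c) * (c / p * s + 1) := by
          have h : (1 + p / c) * (c / p * s + 1) = 1 + s + (p / c + c / p * s) := by
            field_simp
            ring
          rw [h]
          exact le_add_of_nonneg_right (by positivity)
      _ ≤ _ := by
          gcongr
          exact Real.add_one_le_exp _
  calc (1 + s) ^ p ≤ ((1 + p / c) * Real.exp (c / p * s)) ^ p := by gcongr
    _ = (1 + p / c) ^ p * Real.exp (c * s) := by
        rw [Real.mul_rpow (by positivity) (Real.exp_pos _).le, ← Real.exp_mul]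
        congr 2
        field_simp

lemma intervalIntegral_exp_neg_mul_le {c : ℝ} (hc : 0 < c) (t : ℝ) :
    ∫ s in (0 : ℝ)..t, Real.exp (-c * s) ≤ 1 / c := by
  rw [intervalIntegral.integral_comp_mul_left Real.exp (neg_ne_zero.mpr hc.ne'), integral_exp,
    smul_eq_mul, mul_zero, Real.exp_zero, inv_neg, neg_mul, ← mul_neg, neg_sub, one_div]
  exact mul_le_of_le_one_right (inv_pos.mpr hc).le (sub_le_self _ (Real.exp_pos _).le)

/-- The uniform-in-time convolution bound for the decay function `(1+t)e^{-κt}`: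
for `κ > 0` and `p > 1` there is `C > 0` (depending only on `κ` and `p`) with
`∫₀ᵗ (1+t-s) e^{-κ(t-s)} (1+s)^p e^{-κps} ds ≤ C (1+t) e^{-κt}` for all `t ≥ 0`. -/
theorem critical_decay_convolution_bound (κ p : ℝ) (hκ : 0 < κ) (hp : 1 < p) :
    ∃ C : ℝ, 0 < C ∧ ∀ t : ℝ, 0 ≤ t →
      (∫ s in (0 : ℝ)..t,
          (1 + t - s) * Real.exp (-κ * (t - s)) * (1 + s) ^ p * Real.exp (-κ * p * s)) ≤
        C * (1 + t) * Real.exp (-κ * t) := by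
  have hp0 : 0 < p := by linarith
  obtain ⟨c, hc, hcp⟩ : ∃ c : ℝ, 0 < c ∧ κ * (p - 1) = 2 * c :=
    ⟨κ * (p - 1) / 2, by have := mul_pos hκ (sub_pos.mpr hp); positivity, by ring⟩
  refine ⟨(1 + p / c) ^ p * (1 / c), by positivity, fun t ht => ?_⟩
  have hpow : Continuous fun s : ℝ => (1 + s) ^ p :=
    (continuous_const.add continuous_id).rpow_const fun _ => Or.inr hp0.le
  calc ∫ s in (0 : ℝ)..t,
          (1 + t - s) * Real.exp (-κ * (t - s)) * (1 + s) ^ p * Real.exp (-κ * p * s)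
      ≤ ∫ s in (0 : ℝ)..t,
          (1 + p / c) ^ p * (1 + t) * Real.exp (-κ * t) * Real.exp (-c * s) := by
        refine intervalIntegral.integral_mono_on ht
          (Continuous.intervalIntegrable (by fun_prop) _ _)
          (Continuous.intervalIntegrable (by fun_prop) _ _) fun s hs => ?_
        obtain ⟨hs0, hst⟩ := hs
        calc (1 + t - s) * Real.exp (-κ * (t - s)) * (1 + s) ^ p * Real.exp (-κ * p * s)
            ≤ (1 + t) * Real.exp (-κ * (t - s)) * ((1 + p / c) ^ p * Real.exp (c * s)) *
                Real.exp (-κ * p * s) := by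
              gcongr
              · linarith
              · exact one_add_rpow_le_mul_exp hp0 hc hs0
          _ = (1 + p / c) ^ p * (1 + t) *
                (Real.exp (-κ * (t - s)) * Real.exp (c * s) * Real.exp (-κ * p * s)) := by ring
          _ = (1 + p / c) ^ p * (1 + t) * Real.exp (-κ * t) * Real.exp (-c * s) := by
              rw [mul_assoc _ (Real.exp (-κ * t)), ← Real.exp_add, ← Real.exp_add, ← Real.exp_add]
              congr 2
              linear_combination -s * hcp
    _ = (1 + p / c) ^ p * (1 + t) * Real.exp (-κ * t) * ∫ s in (0 : ℝ)..t, Real.exp (-c * s) :=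
        intervalIntegral.integral_const_mul _ _
    _ ≤ (1 + p / c) ^ p * (1 + t) * Real.exp (-κ * t) * (1 / c) := by
        gcongr
        exact intervalIntegral_exp_neg_mul_le hc t
    _ = (1 + p / c) ^ p * (1 / c) * (1 + t) * Real.exp (-κ * t) := by ring
end

section
/- Let p ≥ 1 and T ∈ (0, ∞]. Let F : [0, T) → ℝ be continuously differentiable with F(0) ≥ 0 and F'(0) ≥ 0, and suppose that for every t ∈ (0, T), F'(t) − F'(0) + F(t) − F(0) ≥ ∫₀ᵗ |F(s)|ᵖ ds. Then for every t ∈ [0, T), F(t) ≥ F(0) + F'(0)(1 − e^{−t}) + ∫₀ᵗ e^{η−t} ∫₀^η |F(s)|ᵖ ds dη. In particular, F(t) ≥ 0 for all t ∈ [0, T). -/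
/-- The differential-inequality lower bound in the blow-up argument: if
`F : [0,T) → ℝ` (with `T ∈ (0,∞]`, modelled as `T : EReal`) is continuously
differentiable, `F(0) ≥ 0`, `F'(0) ≥ 0`, and
`F'(t) - F'(0) + F(t) - F(0) ≥ ∫₀ᵗ |F(s)|ᵖ ds` on `(0,T)`, then
`F(t) ≥ F(0) + F'(0)(1 - e^{-t}) + ∫₀ᵗ e^{η-t} ∫₀^η |F(s)|ᵖ ds dη`, and in
particular `F(t) ≥ 0`, for all `t ∈ [0,T)`. -/
theorem blowup_functional_lower_bound
    (p : ℝ) (hp : 1 ≤ p) (T : EReal) (hT : (0 : EReal) < T)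
    (F F' : ℝ → ℝ)
    (hderiv : ∀ t : ℝ, 0 ≤ t → (t : EReal) < T →
      HasDerivWithinAt F (F' t) {s : ℝ | 0 ≤ s ∧ (s : EReal) < T} t)
    (hcont : ContinuousOn F' {s : ℝ | 0 ≤ s ∧ (s : EReal) < T})
    (hF0 : 0 ≤ F 0) (hF'0 : 0 ≤ F' 0)
    (hineq : ∀ t : ℝ, 0 < t → (t : EReal) < T →
      (∫ s in (0 : ℝ)..t, |F s| ^ p) ≤ F' t - F' 0 + F t - F 0) :
    ∀ t : ℝ, 0 ≤ t → (t : EReal) < T →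
      F 0 + F' 0 * (1 - Real.exp (-t)) +
          (∫ η in (0 : ℝ)..t, Real.exp (η - t) * ∫ s in (0 : ℝ)..η, |F s| ^ p) ≤ F t ∧
      0 ≤ F t := by
  intro t ht htT
  have hsub : Set.Icc 0 t ⊆ {s : ℝ | 0 ≤ s ∧ (s : EReal) < T} := fun s hs =>
    ⟨hs.1, (EReal.coe_le_coe_iff.2 hs.2).trans_lt htT⟩
  have hFc : ContinuousOn F (Set.Icc 0 t) := fun s hs =>
    (hderiv s hs.1 (hsub hs).2).continuousWithinAt.mono hsub
  have hF'c : ContinuousOn F' (Set.Icc 0 t) := hcont.mono hsub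
  have hpow : ContinuousOn (fun s => |F s| ^ p) (Set.Icc 0 t) :=
    hFc.abs.rpow_const fun _ _ => Or.inr (by linarith)
  have hexp : Continuous fun η : ℝ => Real.exp (η - t) := by fun_prop
  have hI : ContinuousOn (fun η => ∫ s in (0 : ℝ)..η, |F s| ^ p) (Set.Icc 0 t) := by
    have h := intervalIntegral.continuousOn_primitive_interval (μ := MeasureTheory.volume)
      (a := (0 : ℝ)) (b := t) (f := fun s => |F s| ^ p)
      (by rw [Set.uIcc_of_le ht]; exact hpow.integrableOn_Icc)
    rwa [Set.uIcc_of_le ht] at h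
  have hD : ContinuousOn (fun η => Real.exp (η - t) * (F' η - F' 0 + F η - F 0))
      (Set.Icc 0 t) :=
    hexp.continuousOn.mul (((hF'c.sub continuousOn_const).add hFc).sub continuousOn_const)
  have hftc : ∫ η in (0 : ℝ)..t, Real.exp (η - t) * (F' η - F' 0 + F η - F 0) =
      Real.exp (t - t) * (F t - F' 0 - F 0) - Real.exp (0 - t) * (F 0 - F' 0 - F 0) := by
    refine intervalIntegral.integral_eq_sub_of_hasDerivAt_of_le ht
      (f := fun η => Real.exp (η - t) * (F η - F' 0 - F 0))
      (hexp.continuousOn.mul ((hFc.sub continuousOn_const).sub continuousOn_const)) ?_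
      (hD.intervalIntegrable_of_Icc ht)
    intro s hs
    have hFs : HasDerivAt F (F' s) s :=
      (hderiv s hs.1.le (hsub (Set.Ioo_subset_Icc_self hs)).2).hasDerivAt
        (Filter.mem_of_superset (Icc_mem_nhds hs.1 hs.2) hsub)
    have h := (((hasDerivAt_id s).sub_const t).exp).mul ((hFs.sub_const (F' 0)).sub_const (F 0))
    refine h.congr_deriv ?_
    simp only [id]
    ring
  have hmono : (∫ η in (0 : ℝ)..t, Real.exp (η - t) * ∫ s in (0 : ℝ)..η, |F s| ^ p) ≤
      ∫ η in (0 : ℝ)..t, Real.exp (η - t) * (F' η - F' 0 + F η - F 0) := by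
    refine intervalIntegral.integral_mono_on ht
      ((hexp.continuousOn.mul hI).intervalIntegrable_of_Icc ht)
      (hD.intervalIntegrable_of_Icc ht) fun η hη => ?_
    refine mul_le_mul_of_nonneg_left ?_ (Real.exp_pos _).le
    rcases hη.1.eq_or_lt with rfl | h
    · simp
    · exact hineq η h (hsub hη).2
  have hnonneg : 0 ≤ ∫ η in (0 : ℝ)..t, Real.exp (η - t) * ∫ s in (0 : ℝ)..η, |F s| ^ p :=
    intervalIntegral.integral_nonneg ht fun η hη => mul_nonneg (Real.exp_pos _).le
      (intervalIntegral.integral_nonneg hη.1 fun s _ => Real.rpow_nonneg (abs_nonneg _) p)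
  have hbound : 0 ≤ F' 0 * (1 - Real.exp (-t)) :=
    mul_nonneg hF'0 (sub_nonneg.2 (Real.exp_le_one_iff.2 (by linarith)))
  rw [hftc, sub_self, zero_sub, Real.exp_zero] at hmono
  constructor <;> linarith
end
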